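/- Let μ : ℝⁿ → ℝ be three times continuously differentiable and let w : ℝⁿ → ℝⁿ be a three times continuously differentiable vector field with div w = 0 everywhere. Then pointwise ∑_{j=1}^n ∑_{k=1}^n ∂_j ∂_k ( μ (∂_k w_j + ∂_j w_k) ) = 2 Δ( ⟨∇μ, w⟩ ) − 2 ∑_{j=1}^n ∑_{k=1}^n ∂_j ( (∂_j ∂_k μ) w_k ). -/

import Mathlib

open scoped RealInnerProductSpace BigOperators

/-- The `j`-th partial derivative of a scalar function on `ℝⁿ`. -/
noncomputable def pd {n : ℕ} (j : Fin n) (f : EuclideanSpace ℝ (Fin n) → ℝ) :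
    EuclideanSpace ℝ (Fin n) → ℝ :=
  fun x => fderiv ℝ f x (EuclideanSpace.single j 1)

/-- The Laplacian `Δ = ∑ⱼ ∂ⱼ²` of a scalar function on `ℝⁿ`. -/
noncomputable def lap {n : ℕ} (f : EuclideanSpace ℝ (Fin n) → ℝ) :
    EuclideanSpace ℝ (Fin n) → ℝ :=
  fun x => ∑ j, pd j (pd j f) x

/-- The divergence `div V = ∑ₖ ∂ₖ Vₖ` of a vector field on `ℝⁿ`. -/
noncomputable def dvg {n : ℕ} (V : EuclideanSpace ℝ (Fin n) → EuclideanSpace ℝ (Fin n)) :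
    EuclideanSpace ℝ (Fin n) → ℝ :=
  fun x => ∑ k, pd k (fun y => V y k) x

section

variable {n : ℕ}

theorem pd_add {f g : EuclideanSpace ℝ (Fin n) → ℝ} (hf : Differentiable ℝ f)
    (hg : Differentiable ℝ g) (j : Fin n) :
    pd j (fun y => f y + g y) = fun y => pd j f y + pd j g y := by
  funext x
  simp [pd, fderiv_fun_add (hf x) (hg x)]

theorem pd_mul {f g : EuclideanSpace ℝ (Fin n) → ℝ} (hf : Differentiable ℝ f)
    (hg : Differentiable ℝ g) (j : Fin n) :
    pd j (fun y => f y * g y) = fun y => pd j f y * g y + f y * pd j g y := by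
  funext x
  simp only [pd, fderiv_fun_mul (hf x) (hg x), add_apply,
    smul_apply, smul_eq_mul]
  ring

theorem pd_sum {ι : Type*} (s : Finset ι) {f : ι → EuclideanSpace ℝ (Fin n) → ℝ}
    (hf : ∀ i, Differentiable ℝ (f i)) (j : Fin n) :
    pd j (fun y => ∑ i ∈ s, f i y) = fun y => ∑ i ∈ s, pd j (f i) y := by
  funext x
  simp [pd, fderiv_fun_sum fun i _ => hf i x]

theorem contDiff_pd {f : EuclideanSpace ℝ (Fin n) → ℝ} {m p : WithTop ℕ∞} (hf : ContDiff ℝ p f)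
    (hmp : m + 1 ≤ p) (j : Fin n) : ContDiff ℝ m (pd j f) :=
  (hf.fderiv_right hmp).clm_apply contDiff_const

theorem pd_comm {f : EuclideanSpace ℝ (Fin n) → ℝ} (hf : ContDiff ℝ 2 f) (j k : Fin n) :
    pd j (pd k f) = pd k (pd j f) := by
  funext x
  have hd : DifferentiableAt ℝ (fderiv ℝ f) x :=
    (hf.fderiv_right (m := 1) (by norm_num)).differentiable one_ne_zero x
  have h (a b : Fin n) : pd a (pd b f) x = fderiv ℝ (fderiv ℝ f) x
      (EuclideanSpace.single a 1) (EuclideanSpace.single b 1) := by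
    change fderiv ℝ (fun y => fderiv ℝ f y (EuclideanSpace.single b 1)) x _ = _
    rw [fderiv_clm_apply hd (differentiableAt_const _)]
    simp
  rw [h, h]
  exact (hf.contDiffAt.isSymmSndFDerivAt (by simp)).eq _ _

/-- If `div w = 0`, then `∑ₖ ∂ₖ(μ ∂ⱼwₖ) = ∑ₖ ∂ₖμ ∂ⱼwₖ`. -/
theorem sum_pd_mul_pd_of_dvg_eq_zero {μ : EuclideanSpace ℝ (Fin n) → ℝ}
    {w : EuclideanSpace ℝ (Fin n) → EuclideanSpace ℝ (Fin n)}
    (hμ : Differentiable ℝ μ) (hw : ∀ k, ContDiff ℝ 2 (fun z => w z k))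
    (hdiv : ∀ x, dvg w x = 0) (j : Fin n) :
    (fun y => ∑ k, pd k (fun z => μ z * pd j (fun z => w z k) z) y)
      = fun y => ∑ k, pd k μ y * pd j (fun z => w z k) y := by
  have hpd (a k : Fin n) : Differentiable ℝ (pd a (fun z => w z k)) :=
    (contDiff_pd (m := 1) (hw k) (by norm_num) a).differentiable one_ne_zero
  have hdiv' : (fun y => ∑ k, pd k (fun z => w z k) y) = fun _ => 0 := funext hdiv
  have h0 (y) : ∑ k, pd k (pd j (fun z => w z k)) y = 0 := by
    have h := congrFun (pd_sum Finset.univ (fun k => hpd k k) j) y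
    rw [hdiv'] at h
    simp only [pd_comm (hw _) _ j, ← h]
    simp [pd]
  funext y
  simp only [pd_mul hμ (hpd j _), Finset.sum_add_distrib, ← Finset.mul_sum, h0, mul_zero, add_zero]

end

/-- For `μ : ℝⁿ → ℝ` of class `C³` and a `C³` divergence-free vector field `w`,
`∑ⱼ∑ₖ ∂ⱼ∂ₖ(μ(∂ₖwⱼ + ∂ⱼwₖ)) = 2Δ⟨∇μ, w⟩ − 2 ∑ⱼ∑ₖ ∂ⱼ((∂ⱼ∂ₖμ) wₖ)`. -/
theorem double_div_stress_eq_lap_inner {n : ℕ}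
    (μ : EuclideanSpace ℝ (Fin n) → ℝ) (hμ : ContDiff ℝ 3 μ)
    (w : EuclideanSpace ℝ (Fin n) → EuclideanSpace ℝ (Fin n))
    (hw : ContDiff ℝ 3 w) (hdiv : ∀ x, dvg w x = 0)
    (x : EuclideanSpace ℝ (Fin n)) :
    (∑ j, ∑ k, pd j (pd k
        (fun y => μ y * (pd k (fun z => w z j) y + pd j (fun z => w z k) y))) x)
      = 2 * lap (fun y => ∑ k, pd k μ y * w y k) x
        - 2 * ∑ j, ∑ k, pd j (fun y => pd j (pd k μ) y * w y k) x := by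
  have hwk (k : Fin n) : ContDiff ℝ 3 (fun z => w z k) := contDiff_euclidean.1 hw k
  have hwk2 (k : Fin n) : ContDiff ℝ 2 (fun z => w z k) := (hwk k).of_le (by norm_num)
  have hwd (k : Fin n) : Differentiable ℝ (fun z => w z k) :=
    (hwk k).differentiable (by norm_num)
  have hμd : Differentiable ℝ μ := hμ.differentiable (by norm_num)
  have hpw (j k : Fin n) : ContDiff ℝ 2 (pd j (fun z => w z k)) :=
    contDiff_pd (hwk k) (by norm_num) j
  have hpwd (j k : Fin n) : Differentiable ℝ (pd j (fun z => w z k)) :=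
    (hpw j k).differentiable (by norm_num)
  have hpμ (k : Fin n) : ContDiff ℝ 2 (pd k μ) := contDiff_pd hμ (by norm_num) k
  have hpμd (k : Fin n) : Differentiable ℝ (pd k μ) := (hpμ k).differentiable (by norm_num)
  have hppμd (j k : Fin n) : Differentiable ℝ (pd j (pd k μ)) :=
    (contDiff_pd (m := 1) (hpμ k) (by norm_num) j).differentiable one_ne_zero
  have hA (j k : Fin n) : ContDiff ℝ 2 (fun y => μ y * pd j (fun z => w z k) y) :=
    (hμ.of_le (by norm_num)).mul (hpw j k)
  have hAd (j k : Fin n) : Differentiable ℝ (fun y => μ y * pd j (fun z => w z k) y) :=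
    (hA j k).differentiable (by norm_num)
  have hpAd (a j k : Fin n) : Differentiable ℝ (pd a (fun y => μ y * pd j (fun z => w z k) y)) :=
    (contDiff_pd (m := 1) (hA j k) (by norm_num) a).differentiable one_ne_zero
  have hlhs : (∑ j, ∑ k, pd j (pd k
        (fun y => μ y * (pd k (fun z => w z j) y + pd j (fun z => w z k) y))) x)
      = 2 * ∑ j, ∑ k, pd j (pd k (fun y => μ y * pd j (fun z => w z k) y)) x := by
    simp only [mul_add, pd_add (hAd _ _) (hAd _ _), pd_add (hpAd _ _ _) (hpAd _ _ _),
      Finset.sum_add_distrib, two_mul]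
    congr 1
    rw [Finset.sum_comm]
    exact Finset.sum_congr rfl fun j _ => Finset.sum_congr rfl fun k _ =>
      congrFun (pd_comm (hA j k) k j) x
  have hdivdiv (j : Fin n) : ∑ k, pd j (pd k (fun y => μ y * pd j (fun z => w z k) y)) x
      = ∑ k, pd j (fun y => pd k μ y * pd j (fun z => w z k) y) x := by
    have h1 := congrFun (pd_sum Finset.univ (fun k => hpAd k j k) j) x
    have h2 := congrFun (pd_sum Finset.univ
      (f := fun k y => pd k μ y * pd j (fun z => w z k) y)
      (fun k => (hpμd k).mul (hpwd j k)) j) x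
    rw [← h1, ← h2, sum_pd_mul_pd_of_dvg_eq_zero hμd hwk2 hdiv j]
  have hlap : lap (fun y => ∑ k, pd k μ y * w y k) x
      = ∑ j, ∑ k, pd j (fun y => pd j (pd k μ) y * w y k) x
        + ∑ j, ∑ k, pd j (fun y => pd k μ y * pd j (fun z => w z k) y) x := by
    rw [lap, ← Finset.sum_add_distrib]
    refine Finset.sum_congr rfl fun j _ => ?_
    have hB (k : Fin n) : Differentiable ℝ (fun y => pd j (pd k μ) y * w y k) :=
      (hppμd j k).mul (hwd k)
    have hC (k : Fin n) : Differentiable ℝ (fun y => pd k μ y * pd j (fun z => w z k) y) :=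
      (hpμd k).mul (hpwd j k)
    rw [pd_sum Finset.univ (f := fun k y => pd k μ y * w y k) (fun k => (hpμd k).mul (hwd k)) j]
    simp only [pd_mul (hpμd _) (hwd _)]
    rw [pd_sum Finset.univ
      (f := fun k y => pd j (pd k μ) y * w y k + pd k μ y * pd j (fun z => w z k) y)
      (fun k => (hB k).add (hC k)) j, ← Finset.sum_add_distrib]
    exact Finset.sum_congr rfl fun k _ => congrFun (pd_add (hB k) (hC k) j) x
  rw [hlhs, hlap, Finset.sum_congr rfl fun j _ => hdivdiv j]
  ring
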